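/- (Estimation error bound, Lemma 1.) Let $\mathcal X\subseteq\mathbb R^n$ be a bounded set with $0\in\mathcal X$, let $R:=\sup_{y\in\mathcal X}\|y\|$, and let $\mathcal U\subseteq\mathbb R^m$. Let $f:\mathbb R^n\to\mathbb R^n$ and $g:\mathbb R^n\to\mathbb R^{n\times m}$ be such that $M:=\sup_{y\in\mathcal X,\,w\in\mathcal U}\|f(y)+g(y)w\|$ is finite, the set over which it is taken being non-empty (for compact $\mathcal X,\mathcal U$ and continuous $f,g$ both suprema are maxima). Let $d:\mathbb R^n\to\mathbb R^n$ satisfy $\|d(y)-d(z)\|\le l_d\|y-z\|$ for all $y,z\in\mathcal X$, with a constant $l_d\ge 0$, and $\|d(0)\|\le b_d$. Norms are Euclidean. Set $\theta:=l_dR+b_d$ and $\eta:=l_d(M+\theta)$, let $a>0$, and for $T>0$ put $$\gamma(T):=2\sqrt n\,\eta\,T+\sqrt n\,(1-e^{-aT})\,\theta .$$ Let $T>0$, let $u:[0,\infty)\to\mathcal U$ be an input and let $x:[0,\infty)\to\mathcal X$ be a solution of $$\dot x(t)=f(x(t))+g(x(t))u(t)+d(x(t)).$$ Let $\hat x,\hat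 d:[0,\infty)\to\mathbb R^n$ satisfy $\hat x(0)=x(0)$ and, with $\tilde x:=\hat x-x$, $$\dot{\hat x}(t)=f(x(t))+g(x(t))u(t)+\hat d(t)-a\,\tilde x(t),$$ $$\hat d(t)=\hat d(iT)\ \text{ for } t\in[iT,(i+1)T),\qquad \hat d(iT)=-\frac{a}{e^{aT}-1}\,\tilde x(iT),\qquad i=0,1,2,\dots$$ Since $\hat d$ jumps at the sampling instants, both differential equations are understood in the sense of Carathéodory: the right-hand side is integrable in $t$ on bounded intervals and the solution equals its initial value plus the integral of the right-hand side (equivalently, the solution is locally absolutely continuous and the equation holds for almost every $t\ge0$). Then $$\|\hat d(t)-d(x(t))\|\le\theta\quad\text{for all }0\le t<T,\qquad \|\hat d(t)-d(x(t))\|\le\gamma(T)\quad\text{for all }t\ge T .$$ Moreover, $\lim_{T\to0^+}\gamma(T)=0$. -/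

import Mathlib

noncomputable section

/-- `z` solves `z' = F` on `[0, ∞)` in the sense of Carathéodory: `F` is integrable on bounded
intervals and `z` is its indefinite integral. Equivalently, `z` is locally absolutely continuous
on `[0, ∞)` with `z'(t) = F t` for almost every `t`. The right-hand sides considered here
are discontinuous in time, so a derivative need not exist at every instant. -/
def IsCaratheodorySolution {n : ℕ} (z F : ℝ → EuclideanSpace ℝ (Fin n)) : Prop :=
  ∀ t : ℝ, 0 ≤ t →
    IntervalIntegrable F MeasureTheory.volume 0 t ∧ z t = z 0 + ∫ s in (0 : ℝ)..t, F s

/-- `x` is a trajectory of `x' = f(x) + g(x) u + d(x)` with state in `X` and input in `U`. -/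
structure IsTrajectory {n m : ℕ} (X : Set (EuclideanSpace ℝ (Fin n)))
    (U : Set (EuclideanSpace ℝ (Fin m)))
    (f : EuclideanSpace ℝ (Fin n) → EuclideanSpace ℝ (Fin n))
    (g : EuclideanSpace ℝ (Fin n) → EuclideanSpace ℝ (Fin m) →L[ℝ] EuclideanSpace ℝ (Fin n))
    (d : EuclideanSpace ℝ (Fin n) → EuclideanSpace ℝ (Fin n))
    (u : ℝ → EuclideanSpace ℝ (Fin m)) (x : ℝ → EuclideanSpace ℝ (Fin n)) : Prop where
  state_mem : ∀ t : ℝ, 0 ≤ t → x t ∈ X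
  input_mem : ∀ t : ℝ, 0 ≤ t → u t ∈ U
  dynamics : IsCaratheodorySolution x (fun t => f (x t) + g (x t) (u t) + d (x t))

/-- `xhat`, `dhat` are the outputs of the disturbance observer with gain `a` and sampling
time `T` run along `x`, `u`: state predictor, initialized at the true state, and
piecewise-constant estimation law. -/
structure IsDisturbanceObserver {n m : ℕ}
    (f : EuclideanSpace ℝ (Fin n) → EuclideanSpace ℝ (Fin n))
    (g : EuclideanSpace ℝ (Fin n) → EuclideanSpace ℝ (Fin m) →L[ℝ] EuclideanSpace ℝ (Fin n))
    (a T : ℝ) (u : ℝ → EuclideanSpace ℝ (Fin m))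
    (x xhat dhat : ℝ → EuclideanSpace ℝ (Fin n)) : Prop where
  init : xhat 0 = x 0
  predictor : IsCaratheodorySolution xhat
    (fun t => f (x t) + g (x t) (u t) + dhat t - a • (xhat t - x t))
  hold : ∀ i : ℕ, ∀ t ∈ Set.Ico ((i : ℝ) * T) (((i : ℝ) + 1) * T), dhat t = dhat ((i : ℝ) * T)
  update : ∀ i : ℕ, dhat ((i : ℝ) * T) =
    -(a / (Real.exp (a * T) - 1)) • (xhat ((i : ℝ) * T) - x ((i : ℝ) * T))

/-- `γ(T) = 2 √n η T + √n (1 - e^{-aT}) θ`. -/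
def errorBound (n : ℕ) (a η θ T : ℝ) : ℝ :=
  2 * Real.sqrt n * η * T + Real.sqrt n * (1 - Real.exp (-(a * T))) * θ

end

namespace IsCaratheodorySolution

variable {n : ℕ} {z z' F F' : ℝ → EuclideanSpace ℝ (Fin n)}

lemma sub_eq_integral (h : IsCaratheodorySolution z F) {s t : ℝ} (hs : 0 ≤ s) (ht : 0 ≤ t) :
    z t - z s = ∫ r in s..t, F r := by
  rw [(h t ht).2, (h s hs).2, ← intervalIntegral.integral_interval_sub_left (h t ht).1 (h s hs).1]
  abel

lemma continuousOn (h : IsCaratheodorySolution z F) : ContinuousOn z (Set.Ici 0) := by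
  intro t ht
  have ht' : (0 : ℝ) ≤ t := ht
  have hc : ContinuousOn (fun s => z 0 + ∫ r in (0 : ℝ)..s, F r) (Set.uIcc 0 (t + 1)) :=
    continuousOn_const.add
      (intervalIntegral.continuousOn_primitive_interval' (h (t + 1) (by linarith)).1
        Set.left_mem_uIcc)
  rw [Set.uIcc_of_le (by linarith)] at hc
  have hc' : ContinuousOn z (Set.Icc 0 (t + 1)) := hc.congr fun s hs => (h s hs.1).2
  refine (hc' t ⟨ht', by linarith⟩).mono_of_mem_nhdsWithin ?_
  rw [← Set.Ici_inter_Iic]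
  exact Filter.inter_mem self_mem_nhdsWithin
    (mem_nhdsWithin_of_mem_nhds (Iic_mem_nhds (by linarith)))

lemma norm_sub_le (h : IsCaratheodorySolution z F) {C : ℝ} (hF : ∀ t, 0 ≤ t → ‖F t‖ ≤ C)
    {s t : ℝ} (hs : 0 ≤ s) (ht : 0 ≤ t) : ‖z t - z s‖ ≤ C * |t - s| := by
  rw [h.sub_eq_integral hs ht]
  refine intervalIntegral.norm_integral_le_of_norm_le_const fun r hr => hF r ?_
  exact (le_min hs ht).trans hr.1.le

lemma sub (h : IsCaratheodorySolution z F) (h' : IsCaratheodorySolution z' F') :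
    IsCaratheodorySolution (fun t => z t - z' t) (fun t => F t - F' t) := by
  intro t ht
  refine ⟨(h t ht).1.sub (h' t ht).1, ?_⟩
  rw [intervalIntegral.integral_sub (h t ht).1 (h' t ht).1]
  change z t - z' t = _
  rw [(h t ht).2, (h' t ht).2, add_sub_add_comm]

/-- Where the right-hand side agrees with a continuous function, the solution has a right
derivative. -/
lemma hasDerivWithinAt_Ici (h : IsCaratheodorySolution z F) {G : ℝ → EuclideanSpace ℝ (Fin n)}
    (hG : ContinuousOn G (Set.Ici 0)) {s t : ℝ} (hs : 0 ≤ s) (hst : s < t)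
    (hFG : ∀ r ∈ Set.Ico s t, F r = G r) : HasDerivWithinAt z (G s) (Set.Ici s) s := by
  have hc : Continuous fun r => G (max 0 r) :=
    hG.comp_continuous (continuous_const.max continuous_id) fun r => Set.mem_Ici.2 (le_max_left _ _)
  have hd : HasDerivAt (fun r => z s + ∫ q in s..r, G (max 0 q)) (G s) s := by
    have := (hc.integral_hasStrictDerivAt s s).hasDerivAt.const_add (z s)
    simpa only [max_eq_right hs] using this
  refine (hd.hasDerivWithinAt).congr_of_eventuallyEq ?_ (by simp)
  have hmem : Set.Ico s t ∈ nhdsWithin s (Set.Ici s) := Ico_mem_nhdsGE hst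
  filter_upwards [hmem] with r hr
  rw [← sub_eq_iff_eq_add', h.sub_eq_integral hs (hs.trans hr.1)]
  refine intervalIntegral.integral_congr fun q hq => ?_
  rw [Set.uIcc_of_le hr.1] at hq
  simp only [max_eq_right (hs.trans hq.1)]
  exact hFG q ⟨hq.1, hq.2.trans_lt hr.2⟩

end IsCaratheodorySolution

/-- Over one sampling period the piecewise-constant law cancels the initial prediction error:
the next estimate, rescaled by `e^{aT}`, is a weighted mean of the disturbance `δ`. -/
lemma norm_exp_smul_estimate_sub_le {n : ℕ} {e F δ : ℝ → EuclideanSpace ℝ (Fin n)}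
    (he : IsCaratheodorySolution e F) {a T t₀ K : ℝ} (ha : 0 < a) (hT : 0 < T) (ht₀ : 0 ≤ t₀)
    (hδ : ContinuousOn δ (Set.Ici 0)) {D c : EuclideanSpace ℝ (Fin n)}
    (hF : ∀ r ∈ Set.Ico t₀ (t₀ + T), F r = D - a • e r - δ r)
    (hD : D = -(a / (Real.exp (a * T) - 1)) • e t₀)
    (hK : ∀ r ∈ Set.Ico t₀ (t₀ + T), ‖c - δ r‖ ≤ K) :
    ‖Real.exp (a * T) • (-(a / (Real.exp (a * T) - 1)) • e (t₀ + T)) - c‖ ≤ K := by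
  have hq : 0 < Real.exp (a * T) - 1 := by
    have := Real.add_one_lt_exp (mul_pos ha hT).ne'
    nlinarith [mul_pos ha hT]
  set q := Real.exp (a * T) with hqdef
  set v := a⁻¹ • (c - D) with hv
  have hGc : ContinuousOn (fun r => D - a • e r - δ r) (Set.Ici 0) :=
    (continuousOn_const.sub (he.continuousOn.const_smul a)).sub hδ
  have hexp : ∀ r, HasDerivAt (fun r => Real.exp (a * (r - t₀)))
      (a * Real.exp (a * (r - t₀))) r := by
    intro r
    have := (((hasDerivAt_id r).sub_const t₀).const_mul a).exp
    simpa [mul_comm] using this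
  have hψ : ∀ r ∈ Set.Ico t₀ (t₀ + T),
      HasDerivWithinAt (fun r => Real.exp (a * (r - t₀)) • (e r + v) - (e t₀ + v))
        (Real.exp (a * (r - t₀)) • (c - δ r)) (Set.Ici r) r := by
    intro r hr
    have h1 := he.hasDerivWithinAt_Ici hGc (ht₀.trans hr.1) hr.2
      fun s hs => hF s ⟨hr.1.trans hs.1, hs.2⟩
    have h2 := ((hexp r).hasDerivWithinAt (s := Set.Ici r)).smul (h1.add_const v)
    refine (h2.sub_const (e t₀ + v)).congr_deriv ?_
    have hav : a • v = c - D := by rw [hv, smul_inv_smul₀ ha.ne']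
    rw [mul_comm a (Real.exp _), mul_smul, ← smul_add, smul_add a, hav]
    congr 1
    abel
  have hcont : ContinuousOn (fun r => Real.exp (a * (r - t₀)) • (e r + v) - (e t₀ + v))
      (Set.Icc t₀ (t₀ + T)) := by
    have h1 : ContinuousOn (fun r => Real.exp (a * (r - t₀))) (Set.Icc t₀ (t₀ + T)) := by fun_prop
    have h2 : ContinuousOn e (Set.Icc t₀ (t₀ + T)) :=
      he.continuousOn.mono fun r hr => Set.mem_Ici.2 (ht₀.trans hr.1)
    exact (h1.smul (h2.add continuousOn_const)).sub continuousOn_const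
  have hB : ∀ r, HasDerivAt (fun r => K / a * (Real.exp (a * (r - t₀)) - 1))
      (Real.exp (a * (r - t₀)) * K) r := by
    intro r
    refine (((hexp r).sub_const 1).const_mul (K / a)).congr_deriv ?_
    field_simp
  have main := image_norm_le_of_norm_deriv_right_le_deriv_boundary hcont hψ (by simp) hB
    (fun r hr => by
      rw [norm_smul, Real.norm_of_nonneg (Real.exp_pos _).le]
      exact mul_le_mul_of_nonneg_left (hK r hr) (Real.exp_pos _).le)
    (Set.right_mem_Icc.2 (by linarith))
  simp only [add_sub_cancel_left, ← hqdef] at main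
  have key : q • (e (t₀ + T) + v) - (e t₀ + v)
      = -(((q - 1) / a) • (q • (-(a / (q - 1)) • e (t₀ + T)) - c)) := by
    rw [hv, hD]
    match_scalars <;> field_simp <;> ring
  rw [key, norm_neg, norm_smul, Real.norm_of_nonneg (div_pos hq ha).le] at main
  refine le_of_mul_le_mul_left (main.trans (le_of_eq ?_)) (div_pos hq ha)
  ring

lemma tendsto_errorBound (n : ℕ) (a η θ : ℝ) :
    Filter.Tendsto (fun T : ℝ => errorBound n a η θ T)
      (nhdsWithin 0 (Set.Ioi 0)) (nhds 0) := by
  have hc : Continuous fun T : ℝ => errorBound n a η θ T := by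
    unfold errorBound
    fun_prop
  have := hc.tendsto 0
  simp only [errorBound, mul_zero, neg_zero, Real.exp_zero, sub_self, zero_mul, add_zero] at this
  exact this.mono_left nhdsWithin_le_nhds

theorem stmt_6 {n m : ℕ}
    (X : Set (EuclideanSpace ℝ (Fin n))) (U : Set (EuclideanSpace ℝ (Fin m)))
    (h0X : (0 : EuclideanSpace ℝ (Fin n)) ∈ X)
    (f : EuclideanSpace ℝ (Fin n) → EuclideanSpace ℝ (Fin n))
    (g : EuclideanSpace ℝ (Fin n) → EuclideanSpace ℝ (Fin m) →L[ℝ] EuclideanSpace ℝ (Fin n))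
    (d : EuclideanSpace ℝ (Fin n) → EuclideanSpace ℝ (Fin n))
    (R : ℝ) (hR : IsLUB {r : ℝ | ∃ y ∈ X, r = ‖y‖} R)
    (M : ℝ) (hM : IsLUB {r : ℝ | ∃ y ∈ X, ∃ w ∈ U, r = ‖f y + g y w‖} M)
    (l_d b_d : ℝ) (hl : 0 ≤ l_d)
    (hlip : ∀ y ∈ X, ∀ z ∈ X, ‖d y - d z‖ ≤ l_d * ‖y - z‖)
    (hd0 : ‖d 0‖ ≤ b_d)
    (θ : ℝ) (hθ : θ = l_d * R + b_d)
    (η : ℝ) (hη : η = l_d * (M + θ))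
    (a : ℝ) (ha : 0 < a) :
    (∀ T : ℝ, 0 < T →
      ∀ (u : ℝ → EuclideanSpace ℝ (Fin m)) (x xhat dhat : ℝ → EuclideanSpace ℝ (Fin n)),
        IsTrajectory X U f g d u x →
        IsDisturbanceObserver f g a T u x xhat dhat →
        (∀ t : ℝ, 0 ≤ t → t < T → ‖dhat t - d (x t)‖ ≤ θ) ∧
        (∀ t : ℝ, T ≤ t → ‖dhat t - d (x t)‖ ≤ errorBound n a η θ T)) ∧
    Filter.Tendsto (fun T : ℝ => errorBound n a η θ T)
      (nhdsWithin 0 (Set.Ioi 0)) (nhds 0) := by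
  refine ⟨?_, tendsto_errorBound n a η θ⟩
  intro T hT u x xhat dhat hx ho
  have hdθ : ∀ y ∈ X, ‖d y‖ ≤ θ := by
    intro y hy
    have h1 := hlip y hy 0 h0X
    rw [sub_zero] at h1
    have h2 : ‖y‖ ≤ R := hR.1 ⟨y, hy, rfl⟩
    have h3 := norm_add_le (d y - d 0) (d 0)
    rw [sub_add_cancel] at h3
    nlinarith [mul_le_mul_of_nonneg_left h2 hl]
  have hspeed : ∀ t, 0 ≤ t → ‖f (x t) + g (x t) (u t) + d (x t)‖ ≤ M + θ := fun t ht =>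
    (norm_add_le _ _).trans (add_le_add
      (hM.1 ⟨x t, hx.state_mem t ht, u t, hx.input_mem t ht, rfl⟩) (hdθ _ (hx.state_mem t ht)))
  have hη0 : 0 ≤ η := by
    rw [hη]
    exact mul_nonneg hl ((norm_nonneg _).trans (hspeed 0 le_rfl))
  have hθ0 : 0 ≤ θ := (norm_nonneg _).trans (hdθ 0 h0X)
  have hdlip : ∀ s t, 0 ≤ s → 0 ≤ t → ‖d (x t) - d (x s)‖ ≤ η * |t - s| := by
    intro s t hs ht
    refine (hlip _ (hx.state_mem t ht) _ (hx.state_mem s hs)).trans ?_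
    rw [hη, mul_assoc]
    exact mul_le_mul_of_nonneg_left (hx.dynamics.norm_sub_le hspeed hs ht) hl
  have hdc : ContinuousOn (fun t => d (x t)) (Set.Ici 0) :=
    (LipschitzOnWith.of_dist_le_mul (K := η.toNNReal) fun t ht s hs => by
      simpa [dist_eq_norm, Real.coe_toNNReal _ hη0] using hdlip s t hs ht).continuousOn
  refine ⟨fun t ht htT => ?_, fun t htT => ?_⟩
  · have h1 := ho.hold 0 t ⟨by simpa using ht, by simpa using htT⟩
    have h2 := ho.update 0
    simp only [Nat.cast_zero, zero_mul, ho.init, sub_self, smul_zero] at h1 h2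
    rw [h1, h2, zero_sub, norm_neg]
    exact hdθ _ (hx.state_mem t ht)
  · have ht0 : 0 ≤ t := hT.le.trans htT
    obtain ⟨i, hi1, hi2⟩ : ∃ i : ℕ, ((i : ℝ) + 1) * T ≤ t ∧ t < ((i : ℝ) + 1 + 1) * T := by
      have h1 : 1 ≤ ⌊t / T⌋₊ := Nat.le_floor (by rw [le_div_iff₀ hT]; simpa using htT)
      obtain ⟨i, hi⟩ := Nat.exists_eq_add_of_le' h1
      have h2 := Nat.floor_le (div_nonneg ht0 hT.le)
      have h3 := Nat.lt_floor_add_one (t / T)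
      rw [hi, le_div_iff₀ hT] at h2
      rw [hi, div_lt_iff₀ hT] at h3
      push_cast at h2 h3
      exact ⟨i, h2, h3⟩
    have hi0 : 0 ≤ (i : ℝ) * T := by positivity
    have hstep : (i : ℝ) * T + T = ((i : ℝ) + 1) * T := by ring
    have hcast : ((i + 1 : ℕ) : ℝ) = (i : ℝ) + 1 := by push_cast; rfl
    have hest := norm_exp_smul_estimate_sub_le (ho.predictor.sub hx.dynamics) ha hT hi0 hdc
      (D := dhat (i * T)) (c := d (x t)) (K := 2 * η * T)
      (fun r hr => by
        rw [← ho.hold i r (by rwa [← hstep])]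
        abel)
      (ho.update i)
      (fun r hr => by
        refine (hdlip r t (hi0.trans hr.1) ht0).trans ?_
        rw [abs_of_nonneg (by linarith [hr.2])]
        nlinarith [mul_le_mul_of_nonneg_left (by linarith [hr.1] : t - r ≤ 2 * T) hη0])
    have hup := ho.update (i + 1)
    have hhold := ho.hold (i + 1) t (by rw [hcast]; exact ⟨hi1, hi2⟩)
    rw [hcast] at hup hhold
    simp only [hstep] at hest
    rw [← hup, ← hhold] at hest
    set p := Real.exp (-(a * T)) with hp
    have hp0 : 0 < p := Real.exp_pos _
    have hp1 : p ≤ 1 := Real.exp_le_one_iff.2 (by nlinarith [mul_pos ha hT])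
    have hpq : p * Real.exp (a * T) = 1 := by rw [hp, ← Real.exp_add]; simp
    have hbound : ‖dhat t - d (x t)‖ ≤ 2 * η * T + (1 - p) * θ := by
      have hsplit : dhat t - d (x t)
          = p • (Real.exp (a * T) • dhat t - d (x t)) - (1 - p) • d (x t) := by
        rw [smul_sub, smul_smul, hpq, sub_smul, one_smul, one_smul]
        abel
      rw [hsplit]
      refine (norm_sub_le _ _).trans (add_le_add ?_ ?_)
      · rw [norm_smul, Real.norm_of_nonneg hp0.le]
        exact (mul_le_of_le_one_left (norm_nonneg _) hp1).trans hest
      · rw [norm_smul, Real.norm_of_nonneg (sub_nonneg.2 hp1)]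
        exact mul_le_mul_of_nonneg_left (hdθ _ (hx.state_mem t ht0)) (sub_nonneg.2 hp1)
    rcases Nat.eq_zero_or_pos n with rfl | hn
    · rw [Subsingleton.elim (dhat t - d (x t)) 0]
      simp [errorBound]
    · have hs : 1 ≤ Real.sqrt n := Real.one_le_sqrt.2 (by exact_mod_cast hn)
      have hnn : 0 ≤ 2 * η * T + (1 - p) * θ := (norm_nonneg _).trans hbound
      calc ‖dhat t - d (x t)‖ ≤ 2 * η * T + (1 - p) * θ := hbound
        _ ≤ Real.sqrt n * (2 * η * T + (1 - p) * θ) := le_mul_of_one_le_left hnn hs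
        _ = errorBound n a η θ T := by rw [errorBound, ← hp]; ring
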